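/- Let (X,d) be a metric space and f : X → ℝ a Lipschitz function. For each fixed s > 0, the function x ↦ varlip f(x,s) = s⁻¹·sup_{y ∈ B(x,s)} |f(x) − f(y)| is lower semicontinuous on X. -/

import Mathlib

open MeasureTheory Metric Filter Set Topology
open scoped ENNReal NNReal

noncomputable section

/-- `f` is a bounded Lipschitz function. -/
def IsBddLipschitz {X : Type*} [PseudoMetricSpace X] (f : X → ℝ) : Prop :=
  (∃ K : ℝ≥0, LipschitzWith K f) ∧ ∃ M : ℝ, ∀ x, |f x| ≤ M

/-- The global Lipschitz constant of `f`. -/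
def glip {X : Type*} [PseudoMetricSpace X] (f : X → ℝ) : ℝ :=
  sInf {K : ℝ | 0 ≤ K ∧ ∀ x y, |f x - f y| ≤ K * dist x y}

/-- `max (sup_X |f|) (global Lipschitz constant of f)`. -/
def lipNorm {X : Type*} [PseudoMetricSpace X] (f : X → ℝ) : ℝ :=
  max (⨆ x, |f x|) (glip f)

/-- The variation of `f` on the open ball `B(x,r)`:
`varlip f x r = r⁻¹ · sup_{y ∈ B(x,r)} |f x - f y|`. -/
def varlip {X : Type*} [PseudoMetricSpace X] (f : X → ℝ) (x : X) (r : ℝ) : ℝ :=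
  r⁻¹ * sSup ((fun y => |f x - f y|) '' ball x r)

/-- The upper variation of `f` at `x` from scale `r` down to `0`:
`Lip f (x,r) = sup_{0 < s ≤ r} varlip f x s`. -/
def bigLipR {X : Type*} [PseudoMetricSpace X] (f : X → ℝ) (x : X) (r : ℝ) : ℝ :=
  ⨆ s : Ioc (0:ℝ) r, varlip f x s.1

/-- The lower variation of `f` at `x` from scale `r` down to `0`:
`lip f (x,r) = inf_{0 < s ≤ r} varlip f x s`. -/
def smlLipR {X : Type*} [PseudoMetricSpace X] (f : X → ℝ) (x : X) (r : ℝ) : ℝ :=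
  ⨅ s : Ioc (0:ℝ) r, varlip f x s.1

/-- The pointwise upper Lipschitz constant
`Lip f (x) = inf_{r>0} sup_{0<s≤r} varlip f x s`. -/
def bigLip {X : Type*} [PseudoMetricSpace X] (f : X → ℝ) (x : X) : ℝ :=
  ⨅ r : Ioi (0:ℝ), bigLipR f x r.1

/-- The pointwise lower Lipschitz constant
`lip f (x) = sup_{r>0} inf_{0<s≤r} varlip f x s`. -/
def smlLip {X : Type*} [PseudoMetricSpace X] (f : X → ℝ) (x : X) : ℝ :=
  ⨆ r : Ioi (0:ℝ), smlLipR f x r.1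

/-- The values defining `varlip f x r` are bounded above when `f` is Lipschitz. -/
theorem LipschitzWith.bddAbove_image_ball {X : Type*} [PseudoMetricSpace X] {f : X → ℝ}
    {K : ℝ≥0} (hf : LipschitzWith K f) (x : X) (r : ℝ) :
    BddAbove ((fun y => |f x - f y|) '' ball x r) := by
  refine ⟨K * r, ?_⟩
  rintro _ ⟨y, hy, rfl⟩
  calc |f x - f y| = dist (f x) (f y) := (Real.dist_eq _ _).symm
    _ ≤ K * dist x y := hf.dist_le_mul x y
    _ ≤ K * r := by
      gcongr
      exact (mem_ball'.1 hy).le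

theorem stmt_1 {X : Type*} [MetricSpace X] (f : X → ℝ) {K : ℝ≥0}
    (hf : LipschitzWith K f) (s : ℝ) (hs : 0 < s) :
    LowerSemicontinuous fun x => varlip f x s := by
  intro x a ha
  have ha' : s * a < sSup ((fun y => |f x - f y|) '' ball x s) :=
    (lt_inv_mul_iff₀ hs).1 ha
  obtain ⟨_, ⟨y, hy, rfl⟩, hay⟩ :=
    exists_lt_of_lt_csSup ((nonempty_ball.2 hs).image _) ha'
  have hcont : Continuous fun z => |f z - f y| :=
    (hf.continuous.sub continuous_const).abs
  filter_upwards [hcont.continuousAt.eventually_const_lt hay,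
    isOpen_ball.mem_nhds (mem_ball_comm.1 hy)] with z haz hz
  exact (lt_inv_mul_iff₀ hs).2 <| haz.trans_le <|
    le_csSup (hf.bddAbove_image_ball z s) ⟨y, mem_ball_comm.1 hz, rfl⟩
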